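/- The extension 0 → gl_+(∞) → L_L → C → 0 does not split in the category of graded Lie algebras: there is no Lie algebra homomorphism s : C → L_L with π ∘ s = id_C such that s sends, for each n > 0, the class of Z_{n,0} to an element of degree n (i.e. a linear combination of generators Z_{a,b} with a − b = n) and the class of Z_{0,n} to an element of degree −n. -/

import Mathlib

/- The ladder insertion-elimination Lie algebra `L_L` of Mencattini–Kreimer,
realized as the complex vector space of finitely supported functions `ℕ × ℕ → ℂ`,
with basis elements `Z n m = single (n, m) 1` and the bilinear bracket determined
on basis elements by formula (e1). -/

noncomputable section

/-- The underlying vector space of the ladder insertion-elimination Lie algebra. -/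
abbrev LL : Type := (ℕ × ℕ) →₀ ℂ

/-- The basis element `Z_{n,m}`. -/
def Z (n m : ℕ) : LL := Finsupp.single (n, m) 1

/-- `Θ(k) = 1` if `k ≥ 0`, and `0` otherwise. -/
def theta (k : ℤ) : ℂ := if 0 ≤ k then 1 else 0

/-- The Kronecker delta `δ_{n,m}`. -/
def kdelta (n m : ℕ) : ℂ := if n = m then 1 else 0

/-- Formula (e1) for the bracket `[Z_{n,m}, Z_{l,s}]` on basis elements, where
`p = (n, m)` and `q = (l, s)`.  (The natural subtractions occurring in the indices
are truncated, but every such term is multiplied by a `theta` coefficient which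
vanishes whenever truncation would occur.) -/
def zb (p q : ℕ × ℕ) : LL :=
  theta ((q.1 : ℤ) - p.2) • Z (q.1 - p.2 + p.1) q.2
    - theta ((q.2 : ℤ) - p.1) • Z q.1 (q.2 - p.1 + p.2)
    - theta ((p.1 : ℤ) - q.2) • Z (p.1 - q.2 + q.1) p.2
    + theta ((p.2 : ℤ) - q.1) • Z p.1 (p.2 - q.1 + q.2)
    - kdelta p.2 q.1 • Z p.1 q.2 + kdelta p.1 q.2 • Z q.1 p.2

/-- The bilinear extension of formula (e1) to all of `L_L`. -/
def br (x y : LL) : LL :=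
  x.sum fun p a => y.sum fun q b => (a * b) • zb p q

end

/-- The element `E_{i,j} = Z_{i,j} − Z_{i+1,j+1}` of `L_L`. -/
noncomputable def E (i j : ℕ) : LL := Z i j - Z (i + 1) (j + 1)

/-- `gl_+(∞)`, the span of the elements `E_{i,j}` (a Lie ideal of `L_L`). -/
noncomputable def glInf : Submodule ℂ LL :=
  Submodule.span ℂ {x : LL | ∃ i j : ℕ, x = E i j}

/-- The degree-`i` homogeneous component `l_i`: the span of the `Z_{a,b}` with `a - b = i`. -/
noncomputable def lgrade (i : ℤ) : Submodule ℂ LL :=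
  Submodule.span ℂ {x : LL | ∃ a b : ℕ, (a : ℤ) - b = i ∧ x = Z a b}

noncomputable section

/-- Extension of the trace on `gl_+(∞)` to `L_L`. -/
def tauL : LL →ₗ[ℂ] ℂ :=
  Finsupp.linearCombination ℂ (fun p : ℕ × ℕ => if p.1 = p.2 then -(p.1 : ℂ) else 0)

/-- The value of the trace cocycle on basis elements. -/
def wt (p q : ℕ × ℕ) : ℂ := if p.1 + q.1 = p.2 + q.2 then (p.2 : ℂ) - p.1 else 0

/-- The trace cocycle. -/
def Bf : LL →ₗ[ℂ] LL →ₗ[ℂ] ℂ :=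
  Finsupp.linearCombination ℂ (fun p : ℕ × ℕ => Finsupp.linearCombination ℂ (wt p))

lemma tauL_Z (a b : ℕ) : tauL (Z a b) = if a = b then -(a : ℂ) else 0 := by
  simp [tauL, Z]

lemma Bf_Z (a b c d : ℕ) : Bf (Z a b) (Z c d) = wt (a, b) (c, d) := by
  simp [Bf, Z]

lemma ite_mul_ite_zero (P Q : Prop) [Decidable P] [Decidable Q] (v : ℂ) (h : ¬ (P ∧ Q)) :
    (if P then (1 : ℂ) else 0) * (if Q then v else 0) = 0 := by
  by_cases hP : P
  · have hQ : ¬ Q := fun hQ => h ⟨hP, hQ⟩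
    simp [hQ]
  · simp [hP]

lemma tau_zb (p q : ℕ × ℕ) : tauL (zb p q) = wt p q := by
  obtain ⟨n, m⟩ := p
  obtain ⟨l, s⟩ := q
  simp only [zb, map_add, map_sub, map_smul, tauL_Z, theta, kdelta, wt, smul_eq_mul]
  by_cases h : n + l = m + s
  · rw [if_pos h]
    rcases lt_trichotomy l m with h1 | h1 | h1
    · obtain ⟨k, rfl⟩ := Nat.exists_eq_add_of_lt h1
      obtain rfl : n = s + k + 1 := by omega
      have e1 : ¬ (0 : ℤ) ≤ (l : ℤ) - ((l + k + 1 : ℕ) : ℤ) := by omega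
      have e2 : ¬ (0 : ℤ) ≤ (s : ℤ) - ((s + k + 1 : ℕ) : ℤ) := by omega
      have e3 : (0 : ℤ) ≤ ((s + k + 1 : ℕ) : ℤ) - s := by omega
      have e4 : (0 : ℤ) ≤ ((l + k + 1 : ℕ) : ℤ) - l := by omega
      rw [if_neg e1, if_neg e2, if_pos e3, if_pos e4, if_pos (by omega : s + k + 1 - s + l = l + k + 1),
        if_pos (by omega : s + k + 1 = l + k + 1 - l + s), if_neg (by omega : ¬ l + k + 1 = l),
        if_neg (by omega : ¬ s + k + 1 = s), show s + k + 1 - s + l = l + k + 1 by omega]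
      push_cast
      split_ifs <;> first | (exfalso; omega) | ring
    · subst h1
      obtain rfl : n = s := by omega
      simp
      ring
    · obtain ⟨k, rfl⟩ := Nat.exists_eq_add_of_lt h1
      obtain rfl : s = n + k + 1 := by omega
      have e1 : (0 : ℤ) ≤ ((m + k + 1 : ℕ) : ℤ) - m := by omega
      have e2 : (0 : ℤ) ≤ ((n + k + 1 : ℕ) : ℤ) - n := by omega
      have e3 : ¬ (0 : ℤ) ≤ (n : ℤ) - ((n + k + 1 : ℕ) : ℤ) := by omega
      have e4 : ¬ (0 : ℤ) ≤ (m : ℤ) - ((m + k + 1 : ℕ) : ℤ) := by omega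
      rw [if_pos e1, if_pos e2, if_neg e3, if_neg e4, if_pos (by omega : m + k + 1 - m + n = n + k + 1),
        if_pos (by omega : m + k + 1 = n + k + 1 - n + m), if_neg (by omega : ¬ m = m + k + 1),
        if_neg (by omega : ¬ n = n + k + 1), show m + k + 1 - m + n = n + k + 1 by omega]
      push_cast
      split_ifs <;> first | (exfalso; omega) | ring
  · rw [if_neg h]
    rw [ite_mul_ite_zero, ite_mul_ite_zero, ite_mul_ite_zero, ite_mul_ite_zero,
      ite_mul_ite_zero, ite_mul_ite_zero]
    · ring
    all_goals omega

lemma tau_br (x y : LL) : tauL (br x y) = Bf x y := by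
  simp only [br, Bf, Finsupp.linearCombination_apply, Finsupp.sum, map_sum, map_smul, tau_zb,
    LinearMap.sum_apply, LinearMap.smul_apply, Finset.smul_sum, smul_smul]

lemma Bf_left (x : LL) (hx : x ∈ glInf) : Bf x = 0 := by
  have : glInf ≤ LinearMap.ker Bf := by
    refine Submodule.span_le.2 ?_
    rintro _ ⟨i, j, rfl⟩
    refine LinearMap.mem_ker.2 (Finsupp.lhom_ext' fun q => LinearMap.ext_ring ?_)
    change Bf (E i j) (Z q.1 q.2) = 0
    rw [E, map_sub, LinearMap.sub_apply, Bf_Z, Bf_Z]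
    simp only [wt]
    split_ifs <;> first | (exfalso; omega) | (push_cast; ring)
  exact this hx

lemma Bf_right (x y : LL) (hy : y ∈ glInf) : Bf x y = 0 := by
  have : glInf ≤ LinearMap.ker Bf.flip := by
    refine Submodule.span_le.2 ?_
    rintro _ ⟨i, j, rfl⟩
    refine LinearMap.mem_ker.2 (Finsupp.lhom_ext' fun q => LinearMap.ext_ring ?_)
    change Bf (Z q.1 q.2) (E i j) = 0
    rw [E, map_sub, Bf_Z, Bf_Z]
    simp only [wt]
    split_ifs <;> first | (exfalso; omega) | (push_cast; ring)
  have h := LinearMap.congr_fun (LinearMap.mem_ker.1 (this hy)) x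
  simpa using h

end

/-- The extension `0 → gl_+(∞) → L_L → C → 0` does not split in
the category of graded Lie algebras: there is no linear section `s` of the
canonical projection `π : L_L → C = L_L/gl_+(∞)` which is a morphism of Lie
algebras (`C` being abelian, this means `[s x, s y] = 0`) and which sends the
class of `Z_{n,0}` to an element of degree `n` and the class of `Z_{0,n}` to an
element of degree `−n`, for every `n > 0`. -/
theorem extension_does_not_split :
    ¬ ∃ s : (LL ⧸ glInf) →ₗ[ℂ] LL,
        (∀ c : LL ⧸ glInf, glInf.mkQ (s c) = c) ∧
        (∀ x y : LL ⧸ glInf, br (s x) (s y) = 0) ∧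
        (∀ n : ℕ, 0 < n →
          s (glInf.mkQ (Z n 0)) ∈ lgrade (n : ℤ) ∧
          s (glInf.mkQ (Z 0 n)) ∈ lgrade (-(n : ℤ))) := by
  rintro ⟨s, hs, hb, -⟩
  have key : ∀ z : LL, s (glInf.mkQ z) - z ∈ glInf := fun z => by
    have h := hs (glInf.mkQ z)
    exact (Submodule.Quotient.eq glInf).1 h
  have h0 := tau_br (s (glInf.mkQ (Z 1 0))) (s (glInf.mkQ (Z 0 1)))
  rw [hb, map_zero] at h0
  have h1 := Bf_left _ (key (Z 1 0))
  have h2 := Bf_right (Z 1 0) _ (key (Z 0 1))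
  rw [map_sub, sub_eq_zero] at h1 h2
  rw [h1, h2, Bf_Z] at h0
  simp [wt] at h0
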